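/- Every bridgeless cubic simple graph contains a perfect matching. That is, if G is a finite simple graph in which every vertex has degree 3 and no edge of G is a bridge, then G has a set M of edges such that every vertex of G is incident to exactly one edge of M. -/

import Mathlib

/-- A set `M` of edges of `G` such that every vertex is incident to exactly one edge of `M`. -/
def IsPerfectMatchingSet {V : Type*} (G : SimpleGraph V) (M : Set (Sym2 V)) : Prop :=
  M ⊆ G.edgeSet ∧ ∀ v : V, ∃! e, e ∈ M ∧ v ∈ e

namespace SimpleGraph

variable {V : Type*} (G : SimpleGraph V) [DecidableRel G.Adj]

theorem even_card_interedges_self (s : Finset V) : Even (G.interedges s s).card := by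
  have h : ∑ _e ∈ G.interedges s s, (1 : ZMod 2) = 0 := by
    refine Finset.sum_involution (fun e _ ↦ e.swap) (fun _ _ ↦ by decide) ?_ ?_ ?_
    · rintro ⟨a, b⟩ hab - h
      exact (G.mem_interedges_iff.mp hab).2.2.ne (congrArg Prod.snd h)
    · exact fun e he ↦ G.swap_mem_interedges_iff.mpr he
    · exact fun e _ ↦ e.swap_swap
  rw [← ZMod.natCast_eq_zero_iff_even]
  simpa using h

theorem card_interedges_univ_right [Fintype V] (s : Finset V) :
    (G.interedges s Finset.univ).card = ∑ v ∈ s, G.degree v := by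
  rw [interedges_def, Finset.card_filter, Finset.sum_product]
  refine Finset.sum_congr rfl fun v _ ↦ ?_
  rw [← Finset.card_filter, ← card_neighborFinset_eq_degree, neighborFinset_eq_filter]

theorem card_interedges_comm (s t : Finset V) :
    (G.interedges s t).card = (G.interedges t s).card :=
  have := G.symm
  Rel.card_interedges_comm s t

theorem card_interedges_self_add_card_interedges_compl [Fintype V] [DecidableEq V]
    (s : Finset V) :
    (G.interedges s s).card + (G.interedges s sᶜ).card = ∑ v ∈ s, G.degree v := by
  rw [← G.card_interedges_univ_right, ← Finset.card_union_of_disjoint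
    (G.interedges_disjoint_right s disjoint_compl_right)]
  congr 1
  ext e
  simp only [Finset.mem_union, mem_interedges_iff, Finset.mem_compl, Finset.mem_univ]
  tauto

variable {G}

/-- An edge that is the only one leaving a set of vertices is a bridge. -/
theorem isBridge_of_interedges_compl_eq_singleton [Fintype V] [DecidableEq V] {s : Finset V}
    {a b : V} (h : G.interedges s sᶜ = {(a, b)}) : G.IsBridge s(a, b) := by
  have hab : (a, b) ∈ G.interedges s sᶜ := by simp [h]
  rw [mk_mem_interedges_iff, Finset.mem_compl] at hab
  rw [isBridge_iff]
  rintro ⟨p⟩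
  obtain ⟨d, -, hd, hd'⟩ := p.exists_boundary_dart (s : Set V) hab.1 hab.2.1
  have hadj := d.adj
  rw [deleteEdges_adj] at hadj
  have hmem : (d.fst, d.snd) ∈ G.interedges s sᶜ :=
    G.mk_mem_interedges_iff.mpr ⟨hd, Finset.mem_compl.mpr hd', hadj.1⟩
  rw [h, Finset.mem_singleton, Prod.mk.injEq] at hmem
  exact hadj.2 (by rw [hmem.1, hmem.2]; rfl)

/-- In a bridgeless graph whose degrees are odd, at least three edges leave any odd set of
vertices. -/
theorem three_le_card_interedges_compl [Fintype V] [DecidableEq V]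
    (hdeg : ∀ v, Odd (G.degree v)) (hbridge : ∀ e ∈ G.edgeSet, ¬ G.IsBridge e)
    {s : Finset V} (hs : Odd s.card) : 3 ≤ (G.interedges s sᶜ).card := by
  have hsum : Odd (∑ v ∈ s, G.degree v) := by
    rw [Finset.odd_sum_iff_odd_card_odd]
    simpa [hdeg] using hs
  rw [← card_interedges_self_add_card_interedges_compl] at hsum
  have hodd : Odd (G.interedges s sᶜ).card :=
    (Nat.odd_add'.mp hsum).mpr (G.even_card_interedges_self s)
  have hne : (G.interedges s sᶜ).card ≠ 1 := by
    intro h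
    obtain ⟨⟨a, b⟩, hab⟩ := Finset.card_eq_one.mp h
    have hmem : (a, b) ∈ G.interedges s sᶜ := by simp [hab]
    exact hbridge s(a, b) (G.mk_mem_interedges_iff.mp hmem).2.2
      (isBridge_of_interedges_compl_eq_singleton hab)
  obtain ⟨k, hk⟩ := hodd
  omega

/-- **Petersen's theorem**: a bridgeless cubic graph has a perfect matching. -/
theorem exists_isPerfectMatching_of_cubic_of_bridgeless [Fintype V]
    (hcubic : ∀ v, G.degree v = 3) (hbridge : ∀ e ∈ G.edgeSet, ¬ G.IsBridge e) :
    ∃ M : G.Subgraph, M.IsPerfectMatching := by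
  classical
  rw [tutte]
  intro u hu
  let H := ((⊤ : G.Subgraph).deleteVerts u).coe
  let s (c : H.ConnectedComponent) : Finset V := (Subtype.val '' c.supp).toFinset
  have hmem (c : H.ConnectedComponent) (v : V) :
      v ∈ s c ↔ ∃ hv : v ∈ ((⊤ : G.Subgraph).deleteVerts u).verts,
        H.connectedComponentMk ⟨v, hv⟩ = c := by
    simp [s, ConnectedComponent.mem_supp_iff]
  have hodd : ∀ c ∈ H.oddComponents.toFinset, Odd (s c).card := by
    intro c hc
    rw [Set.mem_toFinset] at hc
    rw [← Set.ncard_eq_toFinset_card', Set.ncard_image_of_injective _ Subtype.val_injective]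
    exact hc
  have hsub (c : H.ConnectedComponent) :
      G.interedges (s c) (s c)ᶜ ⊆ G.interedges (s c) u.toFinset := by
    rintro ⟨a, b⟩ hab
    rw [mk_mem_interedges_iff, Finset.mem_compl] at hab
    refine G.mk_mem_interedges_iff.mpr ⟨hab.1, Set.mem_toFinset.mpr ?_, hab.2.2⟩
    by_contra hb
    obtain ⟨ha, hac⟩ := (hmem c a).mp hab.1
    have hbv : b ∈ ((⊤ : G.Subgraph).deleteVerts u).verts := by simpa using hb
    refine hab.2.1 ((hmem c b).mpr ⟨hbv, ?_⟩)
    rw [← hac]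
    refine ConnectedComponent.connectedComponentMk_eq_of_adj ?_
    have ha' : a ∉ u := by simpa using ha
    simp [H, ha', hb, hab.2.2.symm]
  have hdisj : (H.oddComponents.toFinset : Set H.ConnectedComponent).PairwiseDisjoint
      fun c ↦ G.interedges (s c) u.toFinset := by
    intro c _ d _ hcd
    refine G.interedges_disjoint_left (Finset.disjoint_left.mpr fun v hc hd ↦ hcd ?_) _
    obtain ⟨_, hc⟩ := (hmem c v).mp hc
    obtain ⟨_, hd⟩ := (hmem d v).mp hd
    exact hc.symm.trans hd
  have hle : H.oddComponents.toFinset.card * 3 ≤ u.toFinset.card * 3 :=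
    calc H.oddComponents.toFinset.card * 3
        ≤ ∑ c ∈ H.oddComponents.toFinset, (G.interedges (s c) u.toFinset).card := by
          rw [← smul_eq_mul]
          refine Finset.card_nsmul_le_sum _ _ _ fun c hc ↦ ?_
          exact (three_le_card_interedges_compl (fun v ↦ by rw [hcubic]; decide) hbridge
            (hodd c hc)).trans (Finset.card_le_card (hsub c))
      _ = (H.oddComponents.toFinset.biUnion fun c ↦ G.interedges (s c) u.toFinset).card :=
          (Finset.card_biUnion hdisj).symm
      _ ≤ (G.interedges Finset.univ u.toFinset).card :=
          Finset.card_le_card <| Finset.biUnion_subset.mpr fun c _ ↦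
            G.interedges_mono (Finset.subset_univ _) subset_rfl
      _ = u.toFinset.card * 3 := by
          rw [card_interedges_comm, card_interedges_univ_right]
          simp [hcubic]
  rw [IsTutteViolator, Set.ncard_eq_toFinset_card', Set.ncard_eq_toFinset_card'] at hu
  exact absurd (Nat.le_of_mul_le_mul_right hle (by norm_num)) (not_le.mpr (by convert hu))

theorem Subgraph.IsPerfectMatching.isPerfectMatchingSet_edgeSet {G : SimpleGraph V}
    {M : G.Subgraph} (hM : M.IsPerfectMatching) : IsPerfectMatchingSet G M.edgeSet := by
  refine ⟨M.edgeSet_subset, fun v ↦ ?_⟩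
  obtain ⟨w, hw, huniq⟩ := hM.1 (hM.2 v)
  refine ⟨s(v, w), ⟨hw, Sym2.mem_mk_left v w⟩, ?_⟩
  rintro e ⟨he, hve⟩
  obtain ⟨x, rfl⟩ := Sym2.mem_iff_exists.mp hve
  rw [huniq x he]

end SimpleGraph

/-- Petersen's theorem: every bridgeless cubic finite simple graph has a perfect matching. -/
theorem bridgeless_cubic_has_perfect_matching {V : Type*} [Fintype V]
    (G : SimpleGraph V) [DecidableRel G.Adj]
    (hcubic : ∀ v : V, G.degree v = 3)
    (hbridgeless : ∀ e : Sym2 V, ¬ G.IsBridge e) :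
    ∃ M : Set (Sym2 V), IsPerfectMatchingSet G M := by
  obtain ⟨M, hM⟩ := SimpleGraph.exists_isPerfectMatching_of_cubic_of_bridgeless hcubic
    fun e _ ↦ hbridgeless e
  exact ⟨M.edgeSet, hM.isPerfectMatchingSet_edgeSet⟩
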